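/- (Protection property of RBIU-δ-CC) Let x ∈ {0,1}^n and γ ∈ ℝ satisfy the cardinality-constrained robustness constraints: for every S₀ ⊆ U with |S₀| ≤ Γ, ∑_{i ∈ C} c_i x_i + ∑_{i ∈ S₀} (c_i + |c_i|)/2 + ∑_{i ∈ U \ S₀} c_i x_i ≤ γ, and for every j ∈ J and every S_j ⊆ U with |S_j| ≤ Γ, ∑_{i ∈ C} a_{ij} x_i + ∑_{i ∈ S_j} (a_{ij} + |a_{ij}|)/2 + ∑_{i ∈ U \ S_j} a_{ij} x_i ≤ b_j + δ_j. Then every implemented outcome y ∈ 𝒰(x) that differs from x in at most Γ uncertain coordinates (i.e., |{ i ∈ U : y_i ≠ x_i }| ≤ Γ) satisfies ∑_{i=1}^n c_i y_i ≤ γ and ∑_{i=1}^n a_{ij} y_i ≤ b_j + δ_j for all j ∈ J. -/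

import Mathlib

/-- The set of implemented outcomes of a binary vector `x`: all binary vectors
agreeing with `x` on the deterministic coordinates `C`. -/
def outcomes (n : ℕ) (C : Finset (Fin n)) (x : Fin n → Bool) : Finset (Fin n → Bool) :=
  Finset.univ.filter (fun y => ∀ i ∈ C, y i = x i)

theorem mul_indicator_le_pos_part (r : ℝ) (p : Bool) :
    r * (if p then 1 else 0) ≤ (r + |r|) / 2 := by
  split_ifs
  · linarith [le_abs_self r]
  · linarith [neg_abs_le r]

/-- A linear form at `y` is bounded by its value at `x` with each coefficient replaced by its
positive part on the coordinates outside `C` where `y` and `x` differ. -/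
theorem sum_mul_indicator_le_protected {ι : Type*} [Fintype ι] [DecidableEq ι] (C : Finset ι)
    (r : ι → ℝ) (x y : ι → Bool) (hC : ∀ i ∈ C, y i = x i) :
    ∑ i, r i * (if y i then 1 else 0) ≤
      ∑ i ∈ C, r i * (if x i then 1 else 0) +
        ∑ i ∈ Cᶜ.filter (fun i => y i ≠ x i), (r i + |r i|) / 2 +
        ∑ i ∈ Cᶜ \ Cᶜ.filter (fun i => y i ≠ x i), r i * (if x i then 1 else 0) := by
  rw [← Finset.sum_add_sum_compl C, add_assoc,
    ← Finset.sum_sdiff (Finset.filter_subset (fun i => y i ≠ x i) Cᶜ),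
    add_comm (∑ i ∈ Cᶜ \ _, _)]
  refine add_le_add (Finset.sum_congr rfl fun i hi => by rw [hC i hi]).le
    (add_le_add (Finset.sum_le_sum fun i _ => mul_indicator_le_pos_part (r i) (y i))
      (Finset.sum_congr rfl fun i hi => ?_).le)
  have hyx : y i = x i := by
    by_contra h
    exact (Finset.mem_sdiff.1 hi).2 (Finset.mem_filter.2 ⟨(Finset.mem_sdiff.1 hi).1, h⟩)
  rw [hyx]

/-- (Protection property of RBIU-δ-CC) If `x` and `γ` satisfy the
cardinality-constrained robustness constraints for all subsets of uncertain
indices of size at most `Γ`, then every implemented outcome `y ∈ 𝒰(x)`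
differing from `x` in at most `Γ` uncertain coordinates satisfies
`∑ c i y i ≤ γ` and `∑ a i j y i ≤ b j + δ j` for all `j`. -/
theorem cc_protection (n m : ℕ) (C : Finset (Fin n)) (c : Fin n → ℝ)
    (a : Fin n → Fin m → ℝ) (b δ : Fin m → ℝ) (hδ : ∀ j, 0 ≤ δ j)
    (Γ : ℕ) (hΓ1 : 1 ≤ Γ) (hΓ2 : Γ ≤ Cᶜ.card)
    (x : Fin n → Bool) (γ : ℝ)
    (hobj : ∀ S ∈ Cᶜ.powerset, S.card ≤ Γ →
      ∑ i ∈ C, c i * (if x i then 1 else 0) +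
        ∑ i ∈ S, (c i + |c i|) / 2 +
        ∑ i ∈ Cᶜ \ S, c i * (if x i then 1 else 0) ≤ γ)
    (hcons : ∀ j : Fin m, ∀ S ∈ Cᶜ.powerset, S.card ≤ Γ →
      ∑ i ∈ C, a i j * (if x i then 1 else 0) +
        ∑ i ∈ S, (a i j + |a i j|) / 2 +
        ∑ i ∈ Cᶜ \ S, a i j * (if x i then 1 else 0) ≤ b j + δ j) :
    ∀ y ∈ outcomes n C x, (Cᶜ.filter (fun i => y i ≠ x i)).card ≤ Γ →
      (∑ i, c i * (if y i then 1 else 0)) ≤ γ ∧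
      ∀ j : Fin m, (∑ i, a i j * (if y i then 1 else 0)) ≤ b j + δ j := by
  intro y hy hcard
  have hC : ∀ i ∈ C, y i = x i := (Finset.mem_filter.1 hy).2
  have hS := Finset.mem_powerset.2 (Finset.filter_subset (fun i => y i ≠ x i) Cᶜ)
  exact ⟨(sum_mul_indicator_le_protected C c x y hC).trans (hobj _ hS hcard),
    fun j => (sum_mul_indicator_le_protected C (fun i => a i j) x y hC).trans
      (hcons j _ hS hcard)⟩
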